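/- Let L be a finite-dimensional abelian restricted Lie algebra over an algebraically closed field F of characteristic p > 0, and let H be a restricted Lie algebra over F such that u(L) ≅ u(H) as F-algebras. Then L ≅ H as restricted Lie algebras. -/

import Mathlib

open UniversalEnvelopingAlgebra

attribute [local instance 100] LieRing.ofAssociativeRing

/-- A restricted Lie algebra over a field `F` of characteristic `p`: a Lie algebra equipped
with a `p`-map `x ↦ x^[p]` satisfying Jacobson's identities.  The additive identity
`(x+y)^[p] = x^[p] + y^[p] + Σ sᵢ(x,y)` (with `sᵢ` the Jacobson polynomials) is expressed
faithfully inside the universal enveloping algebra, where it reads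
`ι((x+y)^[p]) - ι(x^[p]) - ι(y^[p]) = (ι x + ι y)^p - (ι x)^p - (ι y)^p`. -/
class RestrictedLieAlgebra (p : ℕ) (F : Type*) (L : Type*) [Field F]
    [LieRing L] [LieAlgebra F L] : Type _ where
  pOp : L → L
  pOp_smul : ∀ (a : F) (x : L), pOp (a • x) = a ^ p • pOp x
  ad_pOp : ∀ x y : L, ⁅pOp x, y⁆ = ((LieAlgebra.ad F L x) ^ p) y
  pOp_add : ∀ x y : L,
    ι F (pOp (x + y)) - ι F (pOp x) - ι F (pOp y)
      = (ι F x + ι F y) ^ p - (ι F x) ^ p - (ι F y) ^ p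

namespace RestrictedLieAlgebra

variable (p : ℕ) (F : Type*) [Field F]

section Defs

variable (L : Type*) [LieRing L] [LieAlgebra F L] [RestrictedLieAlgebra p F L]

/-- The `p`-map of a restricted Lie algebra. -/
abbrev pmap (x : L) : L := RestrictedLieAlgebra.pOp (p := p) (F := F) x

/-- The relation defining the restricted enveloping algebra as a quotient of the
universal enveloping algebra: `x^p = x^[p]` for all `x ∈ L`. -/
def uRel : UniversalEnvelopingAlgebra F L → UniversalEnvelopingAlgebra F L → Prop :=
  fun a b => ∃ x : L, a = (ι F x) ^ p ∧ b = ι F (pmap p F L x)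

/-- The restricted enveloping algebra `u(L)`: the quotient of the universal enveloping
algebra of `L` by the two-sided ideal generated by `{x^p - x^[p] : x ∈ L}`. -/
abbrev uEnv := RingQuot (uRel p F L)

/-- The canonical (linear) embedding `L → u(L)`. -/
def uemb : L →ₗ[F] uEnv p F L :=
  ((RingQuot.mkAlgHom F (uRel p F L)).toLinearMap).comp (ι F : L →ₗ⁅F⁆ _).toLinearMap

variable [Fact p.Prime]

/-- The augmentation map `ε : u(L) → F`, induced by `x ↦ 0` for `x ∈ L`. -/
noncomputable def aug : uEnv p F L →ₐ[F] F :=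
  RingQuot.liftAlgHom F
    ⟨(UniversalEnvelopingAlgebra.lift F) (0 : L →ₗ⁅F⁆ F), by
      rintro a b ⟨x, rfl, rfl⟩
      simp [UniversalEnvelopingAlgebra.lift_ι_apply,
        zero_pow (Nat.Prime.ne_zero (Fact.out : p.Prime))]⟩

/-- The augmentation ideal `ω(L)`, i.e. the kernel of the augmentation map, as a
subspace of `u(L)`. -/
noncomputable def omegaIdeal : Submodule F (uEnv p F L) :=
  LinearMap.ker (aug p F L).toLinearMap

/-- The image of `L` inside `u(L)`. -/
def lSub : Submodule F (uEnv p F L) := LinearMap.range (uemb p F L)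

end Defs

section Closure

variable {L : Type*} [LieRing L] [LieAlgebra F L] [RestrictedLieAlgebra p F L]

/-- The restricted subalgebra generated by a subset `S` of `L`: the smallest Lie
subalgebra containing `S` which is closed under the `p`-map. -/
def restrictedClosure (S : Set L) : LieSubalgebra F L :=
  sInf {K : LieSubalgebra F L | S ⊆ K ∧ ∀ x ∈ K, pmap p F L x ∈ K}

/-- For a subalgebra `N ⊆ L`, the restricted subalgebra `N^p` generated by all
`x^[p]`, `x ∈ N`. -/
def subPPow (K : LieSubalgebra F L) : LieSubalgebra F L :=
  restrictedClosure p F (pmap p F L '' K)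

end Closure

section PNilpotent

variable (L : Type*) [LieRing L] [LieAlgebra F L] [RestrictedLieAlgebra p F L]

/-- `L` is `p`-nilpotent if `L^{pˢ} = 0` for some `s`, where `L^p` denotes the restricted
subalgebra generated by all `x^[p]`. -/
def IsPNilpotent : Prop :=
  ∃ s : ℕ, (subPPow p F)^[s] (⊤ : LieSubalgebra F L) = ⊥

/-- The derived subalgebra `L' = γ₂(L)` as a submodule of `L`. -/
abbrev derivedSub : Submodule F L := (LieModule.lowerCentralSeries F L L 1).toSubmodule

/-- `L'_p`, the restricted subalgebra generated by `L'`, as a submodule. -/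
def derivedP : Submodule F L :=
  (restrictedClosure p F (derivedSub F L : Set L)).toSubmodule

/-- `L'^p + γ₃(L)`, as a submodule of `L`. -/
def mainIdeal : Submodule F L :=
  (subPPow p F (restrictedClosure p F (derivedSub F L : Set L))).toSubmodule
    ⊔ (LieModule.lowerCentralSeries F L L 2).toSubmodule

end PNilpotent

end RestrictedLieAlgebra

namespace TruncatedPolynomial

open MvPolynomial Module

section NormalForm

variable {F : Type*} [Field F] {ι : Type*}

/-- Polynomials of total degree less than `n`. -/
noncomputable def degreeLT (F : Type*) [Field F] (ι : Type*) (n : ℕ) :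
    Submodule F (MvPolynomial ι F) :=
  restrictSupport F {m | m.degree < n}

lemma mem_degreeLT {n : ℕ} {f : MvPolynomial ι F} :
    f ∈ degreeLT F ι n ↔ ∀ m ∈ f.support, m.degree < n := Iff.rfl

lemma degreeLT_mono {m n : ℕ} (h : m ≤ n) : degreeLT F ι m ≤ degreeLT F ι n :=
  restrictSupport_mono F fun _ hx => lt_of_lt_of_le hx h

lemma mul_mem_degreeLT {m n k : ℕ} {f g : MvPolynomial ι F} (hf : f ∈ degreeLT F ι m)
    (hg : g ∈ degreeLT F ι n) (hk : m + n ≤ k + 1) : f * g ∈ degreeLT F ι k := by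
  classical
  intro x hx
  obtain ⟨a, ha, b, hb, rfl⟩ := Finset.mem_add.1 (support_mul f g hx)
  have h1 : a.degree < m := hf ha
  have h2 : b.degree < n := hg hb
  simp only [Set.mem_ofPred_eq, map_add]
  omega

/-- `f` and `u` agree up to terms of degree less than `n`, where `u` has degree at most `n`. -/
def AgreeTop (n : ℕ) (f u : MvPolynomial ι F) : Prop :=
  u ∈ degreeLT F ι (n + 1) ∧ f - u ∈ degreeLT F ι n

lemma AgreeTop.mul {m n : ℕ} {f g u v : MvPolynomial ι F} (hf : AgreeTop m f u)
    (hg : AgreeTop n g v) : AgreeTop (m + n) (f * g) (u * v) := by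
  refine ⟨mul_mem_degreeLT hf.1 hg.1 (by omega), ?_⟩
  have : f * g - u * v = (f - u) * (g - v) + (f - u) * v + u * (g - v) := by ring
  rw [this]
  refine add_mem (add_mem ?_ ?_) ?_
  · exact mul_mem_degreeLT hf.2 hg.2 (by omega)
  · exact mul_mem_degreeLT hf.2 hg.1 (by omega)
  · exact mul_mem_degreeLT hf.1 hg.2 (by omega)

lemma AgreeTop.one : AgreeTop 0 (1 : MvPolynomial ι F) 1 := by
  classical
  refine ⟨mem_degreeLT.2 fun m hm => ?_, by simp⟩
  have : m = 0 := by
    by_contra h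
    exact (mem_support_iff.1 hm) (by rw [coeff_one, if_neg (Ne.symm h)])
  simp [this]

lemma AgreeTop.pow {n : ℕ} {f u : MvPolynomial ι F} (hf : AgreeTop n f u) (k : ℕ) :
    AgreeTop (k * n) (f ^ k) (u ^ k) := by
  induction k with
  | zero => simpa using AgreeTop.one
  | succ k ih =>
    rw [pow_succ, pow_succ, Nat.succ_mul]
    exact ih.mul hf

lemma AgreeTop.prod {κ : Type*} (s : Finset κ) {n : κ → ℕ} {f u : κ → MvPolynomial ι F}
    (h : ∀ i ∈ s, AgreeTop (n i) (f i) (u i)) :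
    AgreeTop (∑ i ∈ s, n i) (∏ i ∈ s, f i) (∏ i ∈ s, u i) := by
  classical
  induction s using Finset.induction_on with
  | empty => simpa using AgreeTop.one
  | insert a s ha ih =>
    rw [Finset.sum_insert ha, Finset.prod_insert ha, Finset.prod_insert ha]
    exact (h a (Finset.mem_insert_self a s)).mul
      (ih fun i hi => h i (Finset.mem_insert_of_mem hi))

lemma X_mem_degreeLT (i : ι) : (X i : MvPolynomial ι F) ∈ degreeLT F ι 2 := by
  rw [X]
  exact (monomial_mem_restrictSupport F).2 (Or.inl (by simp))

lemma AgreeTop.X (i : ι) : AgreeTop 1 (X i : MvPolynomial ι F) (X i) :=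
  ⟨X_mem_degreeLT i, by simp⟩

variable (p : ℕ) (l : ι → MvPolynomial ι F)

/-- The ideal generated by the polynomials `X i ^ p - l i`. -/
noncomputable def relIdeal : Ideal (MvPolynomial ι F) :=
  Ideal.span (Set.range fun i => X i ^ p - l i)

/-- Polynomials all of whose exponents are less than `p`. -/
noncomputable def truncated (F : Type*) [Field F] (ι : Type*) (p : ℕ) :
    Submodule F (MvPolynomial ι F) :=
  restrictSupport F {m | ∀ i, m i < p}

lemma X_pow_sub_mem_relIdeal (i : ι) : X i ^ p - l i ∈ relIdeal p l :=
  Ideal.subset_span ⟨i, rfl⟩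

/-- The value of `divMap` on a monomial. -/
noncomputable def divMonomial (m : ι →₀ ℕ) : MvPolynomial ι F :=
  m.prod fun i k => (X i ^ p - l i) ^ (k / p) * X i ^ (k % p)

/-- The linear map replacing `X ^ (p a + e)` by `(X ^ p - l) ^ a * X ^ e`. -/
noncomputable def divMap : MvPolynomial ι F →ₗ[F] MvPolynomial ι F :=
  (basisMonomials ι F).constr F (divMonomial p l)

lemma divMap_monomial (m : ι →₀ ℕ) : divMap p l (monomial m 1) = divMonomial p l m := by
  have := (basisMonomials ι F).constr_basis F (divMonomial p l) m
  rwa [coe_basisMonomials] at this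

lemma monomial_one_eq_prod (m : ι →₀ ℕ) :
    (monomial m 1 : MvPolynomial ι F) = m.prod fun i k => X i ^ k := by
  rw [monomial_eq, C_1, one_mul]

variable {p l}

lemma agreeTop_divMonomial (hl : ∀ i, l i ∈ degreeLT F ι p) (m : ι →₀ ℕ) :
    AgreeTop m.degree (divMonomial p l m) (monomial m 1) := by
  have hg : ∀ i, AgreeTop p (X i ^ p - l i) (X i ^ p : MvPolynomial ι F) := fun i => by
    have h := (AgreeTop.X (F := F) i).pow p
    rw [mul_one] at h
    refine ⟨h.1, ?_⟩
    have : X i ^ p - l i - X i ^ p = - l i := by ring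
    rw [this]
    exact neg_mem (hl i)
  rw [monomial_one_eq_prod, divMonomial, Finsupp.degree_apply]
  refine AgreeTop.prod _ fun i _ => ?_
  have h := ((hg i).pow (m i / p)).mul ((AgreeTop.X (F := F) i).pow (m i % p))
  rwa [← pow_mul, ← pow_add, mul_one, Nat.mul_comm, Nat.div_add_mod] at h

lemma divMap_sub_mem (hl : ∀ i, l i ∈ degreeLT F ι p) {n : ℕ} {f : MvPolynomial ι F}
    (hf : f ∈ degreeLT F ι (n + 1)) : divMap p l f - f ∈ degreeLT F ι n := by
  have hle : degreeLT F ι (n + 1) ≤ (degreeLT F ι n).comap (divMap p l - LinearMap.id) := by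
    rw [degreeLT, restrictSupport_eq_span, Submodule.span_le]
    rintro _ ⟨m, hm, rfl⟩
    have h := (agreeTop_divMonomial hl m).2
    simp only [SetLike.mem_coe, Submodule.mem_comap, LinearMap.sub_apply, LinearMap.id_apply,
      divMap_monomial]
    exact degreeLT_mono (Nat.lt_succ_iff.1 hm) h
  exact hle hf

lemma exists_mem_degreeLT (f : MvPolynomial ι F) : ∃ n, f ∈ degreeLT F ι n :=
  ⟨f.support.sup Finsupp.degree + 1, fun _ hm =>
    Nat.lt_succ_of_le (Finset.le_sup (f := Finsupp.degree) hm)⟩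

lemma divMap_injective (hl : ∀ i, l i ∈ degreeLT F ι p) :
    Function.Injective (divMap p l) := by
  rw [← LinearMap.ker_eq_bot, LinearMap.ker_eq_bot']
  intro f hf
  obtain ⟨n, hn⟩ := exists_mem_degreeLT f
  induction n with
  | zero =>
    rw [← MvPolynomial.support_eq_empty, Finset.eq_empty_iff_forall_notMem]
    exact fun m hm => Nat.not_lt_zero _ (mem_degreeLT.1 hn m hm)
  | succ n ih =>
    have h := divMap_sub_mem hl hn
    rw [hf, zero_sub] at h
    exact ih (neg_mem_iff.1 h)

lemma divMap_surjective (hl : ∀ i, l i ∈ degreeLT F ι p) :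
    Function.Surjective (divMap p l) := by
  intro f
  change f ∈ LinearMap.range (divMap p l)
  obtain ⟨n, hn⟩ := exists_mem_degreeLT f
  induction n generalizing f with
  | zero =>
    have : f = 0 := by
      rw [← MvPolynomial.support_eq_empty, Finset.eq_empty_iff_forall_notMem]
      exact fun m hm => Nat.not_lt_zero _ (mem_degreeLT.1 hn m hm)
    rw [this]
    exact zero_mem _
  | succ n ih =>
    have h := sub_mem (LinearMap.mem_range_self (divMap p l) f) (ih _ (divMap_sub_mem hl hn))
    rwa [sub_sub_cancel] at h

lemma divMonomial_of_lt {m : ι →₀ ℕ} (hm : ∀ i, m i < p) :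
    divMonomial p l m = monomial m 1 := by
  rw [monomial_one_eq_prod, divMonomial]
  refine Finset.prod_congr rfl fun i _ => ?_
  simp only [Nat.div_eq_of_lt (hm i), pow_zero, one_mul, Nat.mod_eq_of_lt (hm i)]

lemma divMap_of_mem_truncated {f : MvPolynomial ι F} (hf : f ∈ truncated F ι p) :
    divMap p l f = f := by
  have hle : truncated F ι p ≤ LinearMap.eqLocus (divMap p l) LinearMap.id := by
    rw [truncated, restrictSupport_eq_span, Submodule.span_le]
    rintro _ ⟨m, hm, rfl⟩
    exact (divMap_monomial p l m).trans (divMonomial_of_lt hm)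
  exact hle hf

lemma divMonomial_mem_relIdeal (hp : 0 < p) {m : ι →₀ ℕ} {i : ι} (hi : p ≤ m i) :
    divMonomial p l m ∈ relIdeal p l := by
  have hmem : i ∈ m.support := Finsupp.mem_support_iff.2 (by omega)
  refine Ideal.mem_of_dvd _ (Finset.dvd_prod_of_mem _ hmem) ?_
  refine Ideal.mul_mem_right _ _ (Ideal.pow_mem_of_mem _ (X_pow_sub_mem_relIdeal p l i) _ ?_)
  exact Nat.div_pos hi hp

lemma mul_divMonomial (hp : 0 < p) (m : ι →₀ ℕ) (i : ι) :
    (X i ^ p - l i) * divMonomial p l m = divMonomial p l (m + Finsupp.single i p) := by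
  classical
  have h0 : ∀ j : ι, (X j ^ p - l j) ^ (0 / p) * X j ^ (0 % p) = 1 := by simp
  have hs : ∀ m : ι →₀ ℕ, m.support ⊆ insert i m.support := fun m => Finset.subset_insert _ _
  have hs' : (m + Finsupp.single i p).support ⊆ insert i m.support := by
    intro j hj
    by_contra hc
    simp only [Finset.mem_insert, Finsupp.mem_support_iff, not_or, not_not] at hc
    simp [hc.2, Ne.symm hc.1] at hj
  rw [divMonomial, divMonomial, Finsupp.prod_of_support_subset _ (hs m) _ fun j _ => h0 j,
    Finsupp.prod_of_support_subset _ hs' _ fun j _ => h0 j]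
  rw [← Finset.mul_prod_erase _ _ (Finset.mem_insert_self i m.support),
    ← Finset.mul_prod_erase _ _ (Finset.mem_insert_self i m.support), ← mul_assoc]
  congr 1
  · simp only [Finsupp.add_apply, Finsupp.single_eq_same, Nat.add_mod_right,
      Nat.add_div_right _ hp, pow_succ]
    ring
  · refine Finset.prod_congr rfl fun j hj => ?_
    simp [(Finset.ne_of_mem_erase hj).symm]

/-- No nonzero truncated polynomial lies in the ideal generated by `X i ^ p - l i`. -/
theorem eq_zero_of_mem_truncated_of_mem_relIdeal (hp : 0 < p)
    (hl : ∀ i, l i ∈ degreeLT F ι p) {f : MvPolynomial ι F} (hf : f ∈ truncated F ι p)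
    (hf' : f ∈ relIdeal p l) : f = 0 := by
  set N : Submodule F (MvPolynomial ι F) := restrictSupport F {m | ¬ ∀ i, m i < p}
  have hmul : ∀ i g, (X i ^ p - l i) * g ∈ N.map (divMap p l) := by
    intro i g
    obtain ⟨h, rfl⟩ := divMap_surjective hl g
    have hle : (⊤ : Submodule F (MvPolynomial ι F)) ≤
        (N.map (divMap p l)).comap (LinearMap.mulLeft F (X i ^ p - l i) ∘ₗ divMap p l) := by
      rw [← (basisMonomials ι F).span_eq, Submodule.span_le]
      rintro _ ⟨m, rfl⟩
      refine ⟨monomial (m + Finsupp.single i p) 1, ?_, ?_⟩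
      · refine (monomial_mem_restrictSupport F).2 (Or.inl fun h => ?_)
        have := h i
        simp at this
      · simp only [coe_basisMonomials, LinearMap.comp_apply, LinearMap.mulLeft_apply,
          divMap_monomial, mul_divMonomial hp]
    exact hle (Submodule.mem_top (x := h))
  have hI : ∀ g ∈ relIdeal p l, g ∈ N.map (divMap p l) := by
    intro g hg
    suffices h : ∀ a, a * g ∈ N.map (divMap p l) by simpa using h 1
    refine Submodule.span_induction (p := fun g _ => ∀ a, a * g ∈ N.map (divMap p l))
      ?_ (fun a => by simp) (fun x y _ _ hx hy a => ?_) (fun b x _ hx a => ?_) hg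
    · rintro _ ⟨i, rfl⟩ a
      rw [mul_comm]
      exact hmul i a
    · rw [mul_add]
      exact add_mem (hx a) (hy a)
    · rw [smul_eq_mul, ← mul_assoc]
      exact hx (a * b)
  obtain ⟨g, hg, hgf⟩ := hI f hf'
  rw [← divMap_of_mem_truncated (l := l) hf] at hgf
  obtain rfl := divMap_injective hl hgf
  rw [← MvPolynomial.support_eq_empty, Finset.eq_empty_iff_forall_notMem]
  exact fun m hm => hg hm (hf hm)

/-- Every polynomial is congruent to a truncated one modulo `X i ^ p - l i`. -/
theorem exists_truncated_sub_mem_relIdeal (hp : 0 < p) (hl : ∀ i, l i ∈ degreeLT F ι p)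
    (f : MvPolynomial ι F) : ∃ g ∈ truncated F ι p, f - g ∈ relIdeal p l := by
  have htop : (⊤ : Submodule F (MvPolynomial ι F)) ≤
      (truncated F ι p ⊔ (relIdeal p l).restrictScalars F).comap (divMap p l) := by
    rw [← (basisMonomials ι F).span_eq, Submodule.span_le]
    rintro _ ⟨m, rfl⟩
    simp only [coe_basisMonomials, SetLike.mem_coe, Submodule.mem_comap, divMap_monomial]
    by_cases hm : ∀ i, m i < p
    · rw [divMonomial_of_lt hm]
      exact Submodule.mem_sup_left ((monomial_mem_restrictSupport F).2 (Or.inl hm))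
    · push Not at hm
      obtain ⟨i, hi⟩ := hm
      exact Submodule.mem_sup_right (divMonomial_mem_relIdeal hp hi)
  obtain ⟨h, rfl⟩ := divMap_surjective hl f
  obtain ⟨g, hg, k, hk, hgk⟩ := Submodule.mem_sup.1 (htop (Submodule.mem_top (x := h)))
  exact ⟨g, hg, by rwa [← hgk, add_sub_cancel_left]⟩

end NormalForm

section LinearForm

variable {F V ι : Type*} [Field F] [AddCommGroup V] [Module F V]

/-- The linear form in the variables `X i` with the coordinates of a vector in the basis `b`. -/
noncomputable def linForm (b : Basis ι F V) : V →ₗ[F] MvPolynomial ι F := b.constr F X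

@[simp] lemma linForm_basis (b : Basis ι F V) (i : ι) : linForm b (b i) = X i :=
  b.constr_basis F X i

lemma linForm_mem_of_X_mem (b : Basis ι F V) {N : Submodule F (MvPolynomial ι F)}
    (h : ∀ i, X i ∈ N) (x : V) : linForm b x ∈ N := by
  have hle : (⊤ : Submodule F V) ≤ N.comap (linForm b) := by
    rw [← b.span_eq, Submodule.span_le]
    rintro _ ⟨i, rfl⟩
    simpa using h i
  exact hle (Submodule.mem_top (x := x))

lemma linForm_mem_degreeLT (b : Basis ι F V) {p : ℕ} (hp : 2 ≤ p) (x : V) :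
    linForm b x ∈ degreeLT F ι p :=
  linForm_mem_of_X_mem b (fun i => degreeLT_mono hp (X_mem_degreeLT i)) x

lemma X_mem_truncated {p : ℕ} (hp : 2 ≤ p) (i : ι) : X i ∈ truncated F ι p := by
  classical
  rw [X]
  refine (monomial_mem_restrictSupport F).2 (Or.inl fun j => ?_)
  rw [Finsupp.single_apply]
  split_ifs <;> omega

lemma linForm_mem_truncated (b : Basis ι F V) {p : ℕ} (hp : 2 ≤ p) (x : V) :
    linForm b x ∈ truncated F ι p :=
  linForm_mem_of_X_mem b (X_mem_truncated hp) x

lemma linForm_injective (b : Basis ι F V) : Function.Injective (linForm b) := by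
  have hX : LinearIndependent F (X : ι → MvPolynomial ι F) := by
    have h := (basisMonomials ι F).linearIndependent.comp (fun i : ι => Finsupp.single i 1)
      (Finsupp.single_left_injective one_ne_zero)
    rwa [coe_basisMonomials] at h
  intro x y hxy
  rw [linForm, b.constr_def, LinearMap.comp_apply, LinearMap.comp_apply] at hxy
  simp only [LinearMap.comp_apply, LinearEquiv.coe_coe, Finsupp.lmapDomain_apply,
    Finsupp.linearCombination_mapDomain, Function.id_comp] at hxy
  exact b.repr.injective (hX hxy)

lemma aeval_linForm {A : Type*} [CommRing A] [Algebra F A] (b : Basis ι F V) (f : V →ₗ[F] A)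
    (x : V) : aeval (fun i => f (b i)) (linForm b x) = f x := by
  have : (aeval fun i => f (b i)).toLinearMap ∘ₗ linForm b = f := b.ext fun i => by simp
  exact LinearMap.congr_fun this x

/-- If the `p`-th power of each `x i` is a linear combination of the `x j`, the subalgebra they
generate is spanned by truncated monomials. -/
lemma exists_truncated_of_mem_adjoin {κ A : Type*} [CommRing A] [Algebra F A] {p : ℕ}
    (hp : 2 ≤ p) (x : κ → A) (hx : ∀ i, x i ^ p ∈ Submodule.span F (Set.range x)) {a : A}
    (ha : a ∈ Algebra.adjoin F (Set.range x)) : ∃ P ∈ truncated F κ p, aeval x P = a := by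
  have hl : ∀ i, ∃ l ∈ degreeLT F κ p, aeval x l = x i ^ p := by
    intro i
    have hle : Submodule.span F (Set.range x) ≤
        (degreeLT F κ p).map (aeval (R := F) x).toLinearMap := by
      rw [Submodule.span_le]
      rintro _ ⟨j, rfl⟩
      exact ⟨X j, degreeLT_mono hp (X_mem_degreeLT j), by simp⟩
    obtain ⟨l, hl, h⟩ := hle (hx i)
    exact ⟨l, hl, h⟩
  choose l hl hlx using hl
  rw [Algebra.adjoin_range_eq_range_aeval] at ha
  obtain ⟨Q, rfl⟩ := ha
  obtain ⟨P, hP, hQP⟩ := exists_truncated_sub_mem_relIdeal (by omega) hl Q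
  refine ⟨P, hP, ?_⟩
  have hker : relIdeal p l ≤ RingHom.ker (aeval (R := F) x) := by
    rw [relIdeal, Ideal.span_le]
    rintro _ ⟨i, rfl⟩
    simp [RingHom.mem_ker, hlx]
  have := hker hQP
  rw [RingHom.mem_ker, map_sub, sub_eq_zero] at this
  exact this.symm

lemma finrank_truncated {κ : Type*} [Finite κ] (p : ℕ) :
    finrank F (truncated F κ p) = p ^ Nat.card κ := by
  have e : {m : κ →₀ ℕ | ∀ i, m i < p} ≃ (κ → Fin p) :=
    { toFun := fun m i => ⟨m.1 i, m.2 i⟩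
      invFun := fun f => ⟨Finsupp.equivFunOnFinite.symm fun i => f i, fun i => (f i).2⟩
      left_inv := fun m => by ext; rfl
      right_inv := fun f => by ext; rfl }
  rw [truncated, finrank_eq_nat_card_basis (basisRestrictSupport F _), Nat.card_congr e,
    Nat.card_fun, Nat.card_fin]

lemma finite_truncated {κ : Type*} [Finite κ] (p : ℕ) : Module.Finite F (truncated F κ p) := by
  have : Finite {m : κ →₀ ℕ | ∀ i, m i < p} := by
    refine Finite.of_injective (β := κ → Fin p) (fun m i => ⟨m.1 i, m.2 i⟩) fun m n h => ?_
    ext i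
    simpa using congrArg Fin.val (congrFun h i)
  exact Module.Finite.of_basis (basisRestrictSupport F {m : κ →₀ ℕ | ∀ i, m i < p})

end LinearForm

section Envelope

variable {F V A : Type*} [Field F] [AddCommGroup V] [Module F V]
  {p : ℕ} [Fact p.Prime] [CharP F p] [CommRing A] [Algebra F A]

/-- `A` is the commutative `F`-algebra generated by `V` subject to `x ^ p = φ x`: in every
finite basis of `V` the only relations are the evident ones. -/
structure IsPowerEnvelope (φ : V →ₛₗ[frobenius F p] V) (f : V →ₗ[F] A) : Prop where
  pow_eq : ∀ x, f x ^ p = f (φ x)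
  adjoin_eq_top : Algebra.adjoin F (Set.range f) = ⊤
  mem_relIdeal : ∀ {ι : Type} [Finite ι] (b : Basis ι F V) (P : MvPolynomial ι F),
    aeval (fun i => f (b i)) P = 0 → P ∈ relIdeal p fun i => linForm b (φ (b i))

variable {φ : V →ₛₗ[frobenius F p] V} {f : V →ₗ[F] A}

lemma pow_eq_of_basis {ι : Type*} [CharP A p] (b : Basis ι F V)
    (h : ∀ i, f (b i) ^ p = f (φ (b i))) (x : V) : f x ^ p = f (φ x) := by
  have hx : x ∈ Submodule.span F (Set.range b) := by
    rw [b.span_eq]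
    exact Submodule.mem_top
  induction hx using Submodule.span_induction with
  | mem x hx =>
    obtain ⟨i, rfl⟩ := hx
    exact h i
  | zero => simp [(Fact.out : p.Prime).ne_zero]
  | add x y _ _ hx hy => rw [map_add, add_pow_char, hx, hy, map_add, map_add]
  | smul a x _ hx => rw [map_smul, smul_pow, hx, map_smulₛₗ, map_smul, frobenius_def]

/-- The commutative algebra generated by `V` subject to `x ^ p = φ x`, presented in a basis. -/
abbrev PowerQuotient {ι : Type*} (φ : V →ₛₗ[frobenius F p] V) (b : Basis ι F V) : Type _ :=
  MvPolynomial ι F ⧸ relIdeal p fun i => linForm b (φ (b i))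

/-- The canonical map to `PowerQuotient`. -/
noncomputable def toPowerQuotient {ι : Type*} (φ : V →ₛₗ[frobenius F p] V) (b : Basis ι F V) :
    V →ₗ[F] PowerQuotient φ b :=
  (Ideal.Quotient.mkₐ F _).toLinearMap ∘ₗ linForm b

lemma linForm_relations_degree {ι : Type*} (φ : V →ₛₗ[frobenius F p] V) (b : Basis ι F V) (i : ι) :
    linForm b (φ (b i)) ∈ degreeLT F ι p :=
  linForm_mem_degreeLT b (Fact.out : p.Prime).two_le _

lemma nontrivial_powerQuotient {ι : Type*} (φ : V →ₛₗ[frobenius F p] V) (b : Basis ι F V) :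
    Nontrivial (PowerQuotient φ b) := by
  have hp := (Fact.out : p.Prime).pos
  refine Ideal.Quotient.nontrivial_iff.2 fun h => one_ne_zero (α := MvPolynomial ι F) ?_
  refine eq_zero_of_mem_truncated_of_mem_relIdeal hp (linForm_relations_degree φ b) ?_
    ((Ideal.eq_top_iff_one _).1 h)
  exact (monomial_mem_restrictSupport F).2 (Or.inl fun i => by simpa using hp)

lemma toPowerQuotient_pow {ι : Type*} (φ : V →ₛₗ[frobenius F p] V) (b : Basis ι F V) (x : V) :
    toPowerQuotient φ b x ^ p = toPowerQuotient φ b (φ x) := by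
  have := nontrivial_powerQuotient φ b
  have : CharP (PowerQuotient φ b) p :=
    charP_of_injective_algebraMap (algebraMap F (PowerQuotient φ b)).injective p
  refine pow_eq_of_basis b (fun i => ?_) x
  have h := Ideal.Quotient.eq_zero_iff_mem.2
    (X_pow_sub_mem_relIdeal p (fun i => linForm b (φ (b i))) i)
  rw [map_sub, sub_eq_zero, map_pow] at h
  simpa [toPowerQuotient] using h

lemma mem_relIdeal_of_toPowerQuotient {ι : Type*} (b : Basis ι F V) (g : A →ₐ[F] PowerQuotient φ b)
    (hg : ∀ x, g (f x) = toPowerQuotient φ b x) (P : MvPolynomial ι F)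
    (hP : aeval (fun i => f (b i)) P = 0) : P ∈ relIdeal p fun i => linForm b (φ (b i)) := by
  have h : g.comp (aeval fun i => f (b i)) =
      Ideal.Quotient.mkₐ F (relIdeal p fun i => linForm b (φ (b i))) := by
    refine MvPolynomial.algHom_ext fun i => ?_
    simp [hg, toPowerQuotient]
  have h' := congrArg g hP
  rw [map_zero, ← AlgHom.comp_apply, h] at h'
  exact Ideal.Quotient.eq_zero_iff_mem.1 h'

/-- `PowerQuotient` is a power envelope. -/
lemma isPowerEnvelope_toPowerQuotient {ι : Type*} (φ : V →ₛₗ[frobenius F p] V)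
    (b : Basis ι F V) : IsPowerEnvelope φ (toPowerQuotient φ b) where
  pow_eq := toPowerQuotient_pow φ b
  adjoin_eq_top := by
    rw [eq_top_iff]
    rintro a -
    obtain ⟨P, rfl⟩ := Ideal.Quotient.mkₐ_surjective F _ a
    induction P using MvPolynomial.induction_on with
    | C r => exact Subalgebra.algebraMap_mem _ r
    | add P Q hP hQ => exact add_mem hP hQ
    | mul_X P i hP =>
      rw [map_mul]
      exact mul_mem hP (Algebra.subset_adjoin ⟨b i, by simp [toPowerQuotient]⟩)
  mem_relIdeal {κ} _ c P hP := by
    refine mem_relIdeal_of_toPowerQuotient c (Ideal.Quotient.liftₐ _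
      (aeval fun i => toPowerQuotient φ c (b i)) ?_) (fun x => ?_) P hP
    · have hle : (relIdeal p fun i => linForm b (φ (b i))) ≤
          RingHom.ker (aeval (R := F) fun i => toPowerQuotient φ c (b i)) := by
        rw [relIdeal, Ideal.span_le]
        rintro _ ⟨i, rfl⟩
        simp [RingHom.mem_ker, aeval_linForm, toPowerQuotient_pow]
      exact fun a ha => hle ha
    · exact aeval_linForm b (toPowerQuotient φ c) x

namespace IsPowerEnvelope

lemma eq_zero_of_mem_truncated (h : IsPowerEnvelope φ f) {ι : Type} [Finite ι]
    (b : Basis ι F V) {P : MvPolynomial ι F}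
    (hP : P ∈ truncated F ι p) (h0 : aeval (fun i => f (b i)) P = 0) : P = 0 :=
  eq_zero_of_mem_truncated_of_mem_relIdeal (Fact.out : p.Prime).pos
    (linForm_relations_degree φ b) hP (h.mem_relIdeal b P h0)

lemma injective [FiniteDimensional F V] (h : IsPowerEnvelope φ f) : Function.Injective f := by
  rw [← LinearMap.ker_eq_bot, LinearMap.ker_eq_bot']
  intro x hx
  have b := finBasis F V
  refine linForm_injective b ?_
  rw [map_zero]
  refine h.eq_zero_of_mem_truncated b
    (linForm_mem_truncated b (Fact.out : p.Prime).two_le x) ?_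
  rw [aeval_linForm, hx]

lemma exists_truncated (h : IsPowerEnvelope φ f) {ι : Type*} (b : Basis ι F V) (a : A) :
    ∃ P ∈ truncated F ι p, aeval (fun i => f (b i)) P = a := by
  have hspan : ∀ x, f x ∈ Submodule.span F (Set.range fun i => f (b i)) := by
    intro x
    have : Set.range (fun i => f (b i)) = f '' Set.range b := by
      rw [← Set.range_comp]
      rfl
    rw [this, ← Submodule.map_span, b.span_eq]
    exact ⟨x, Submodule.mem_top, rfl⟩
  refine exists_truncated_of_mem_adjoin (Fact.out : p.Prime).two_le _ (fun i => ?_) ?_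
  · rw [h.pow_eq]
    exact hspan _
  · have hle : Algebra.adjoin F (Set.range f) ≤
        Algebra.adjoin F (Set.range fun i => f (b i)) := by
      rw [Algebra.adjoin_le_iff]
      rintro _ ⟨x, rfl⟩
      exact Algebra.span_le_adjoin F _ (hspan x)
    rw [h.adjoin_eq_top] at hle
    exact hle Algebra.mem_top

lemma finite [FiniteDimensional F V] (h : IsPowerEnvelope φ f) : Module.Finite F A := by
  have := finite_truncated (F := F) (κ := Fin (finrank F V)) p
  refine Module.Finite.of_surjective
    ((aeval fun i => f (finBasis F V i)).toLinearMap ∘ₗ (truncated F _ p).subtype) fun a => ?_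
  obtain ⟨P, hP, ha⟩ := h.exists_truncated (finBasis F V) a
  exact ⟨⟨P, hP⟩, ha⟩

/-- The subalgebra generated by a `φ`-stable subspace `K` has dimension `p ^ dim K`. -/
lemma finrank_adjoin [FiniteDimensional F V] (h : IsPowerEnvelope φ f) (K : Submodule F V)
    (hK : ∀ x ∈ K, φ x ∈ K) :
    finrank F (Algebra.adjoin F (f '' K)) = p ^ finrank F K := by
  obtain ⟨K', hKK'⟩ := K.exists_isCompl
  let bK := finBasis F K
  let b := (bK.prod (finBasis F K')).map (K.prodEquivOfIsCompl K' hKK')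
  have hb : ∀ i, b (Sum.inl i) = bK i := fun i => by simp [b]
  let x : Fin (finrank F K) → A := fun i => f (bK i)
  have hspan : Submodule.span F (Set.range x) = K.map f := by
    have : Set.range x = (f ∘ₗ K.subtype) '' Set.range bK := by
      rw [← Set.range_comp]
      rfl
    rw [this, ← Submodule.map_span, bK.span_eq, Submodule.map_comp, Submodule.map_top,
      Submodule.range_subtype]
  have hadj : Algebra.adjoin F (f '' K) = Algebra.adjoin F (Set.range x) := by
    rw [← Submodule.map_coe, ← hspan, Algebra.adjoin_span]
  let g : truncated F (Fin (finrank F K)) p →ₗ[F] A :=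
    (aeval x).toLinearMap ∘ₗ (truncated F _ p).subtype
  have hrange : LinearMap.range g = Subalgebra.toSubmodule (Algebra.adjoin F (f '' K)) := by
    rw [hadj]
    ext a
    constructor
    · rintro ⟨P, rfl⟩
      change aeval x P.1 ∈ Algebra.adjoin F (Set.range x)
      rw [Algebra.adjoin_range_eq_range_aeval]
      exact ⟨P.1, rfl⟩
    · intro ha
      obtain ⟨P, hP, hPa⟩ := exists_truncated_of_mem_adjoin (Fact.out : p.Prime).two_le x
        (fun i => by
          rw [hspan, h.pow_eq]
          exact ⟨_, hK _ (bK i).2, rfl⟩) ha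
      exact ⟨⟨P, hP⟩, hPa⟩
  have hinj : Function.Injective g := by
    rw [← LinearMap.ker_eq_bot, LinearMap.ker_eq_bot']
    rintro ⟨P, hP⟩ hgP
    have h0 : rename (Sum.inl : _ → _ ⊕ Fin (finrank F K')) P = 0 := by
      refine h.eq_zero_of_mem_truncated b (fun m hm => ?_) ?_
      · classical
        have hm' : m ∈ (rename (Sum.inl : _ → _ ⊕ Fin (finrank F K')) P).support := hm
        rw [support_rename_of_injective Sum.inl_injective] at hm'
        obtain ⟨n, hn, rfl⟩ := Finset.mem_image.1 hm'
        rintro (i | i)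
        · rw [Finsupp.mapDomain_apply Sum.inl_injective]
          exact hP hn i
        · rw [Finsupp.mapDomain_of_notMem_range _ _ (by simp)]
          exact (Fact.out : p.Prime).pos
      · rw [aeval_rename]
        have hx : (fun i => f (b i)) ∘ Sum.inl = x := funext fun i => congrArg f (hb i)
        rw [hx]
        exact hgP
    have := rename_injective _ Sum.inl_injective (h0.trans (map_zero _).symm)
    exact Subtype.ext this
  have hfin := LinearMap.finrank_range_of_inj hinj
  rw [hrange, finrank_truncated, Nat.card_fin] at hfin
  exact hfin

lemma adjoin_pow_eq [CharP A p] (h : IsPowerEnvelope φ f) (n : ℕ) :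
    Algebra.adjoin F (Set.range fun a : A => a ^ p ^ n) =
      Algebra.adjoin F (f '' Submodule.span F (Set.range φ^[n])) := by
  have hpow : ∀ n x, f x ^ p ^ n = f (φ^[n] x) := by
    intro n x
    induction n with
    | zero => simp
    | succ n ih => rw [pow_succ, pow_mul, ih, h.pow_eq, Function.iterate_succ_apply']
  rw [← Submodule.map_coe, Submodule.map_span, Algebra.adjoin_span]
  apply le_antisymm
  · rw [Algebra.adjoin_le_iff]
    rintro _ ⟨a, rfl⟩
    have ha : a ∈ Algebra.adjoin F (Set.range f) := by
      rw [h.adjoin_eq_top]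
      exact Algebra.mem_top
    change a ^ p ^ n ∈ Algebra.adjoin F (f '' Set.range φ^[n])
    induction ha using Algebra.adjoin_induction with
    | mem x hx =>
      obtain ⟨x, rfl⟩ := hx
      rw [hpow]
      exact Algebra.subset_adjoin ⟨_, ⟨x, rfl⟩, rfl⟩
    | algebraMap r => exact pow_mem (Subalgebra.algebraMap_mem _ r) _
    | add x y _ _ hx hy =>
      rw [add_pow_char_pow]
      exact add_mem hx hy
    | mul x y _ _ hx hy =>
      rw [mul_pow]
      exact mul_mem hx hy
  · rw [Algebra.adjoin_le_iff]
    rintro _ ⟨_, ⟨x, rfl⟩, rfl⟩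
    exact Algebra.subset_adjoin ⟨f x, hpow n x⟩

/-- The ranks of the iterates of `φ` are encoded in the powers of elements of `A`. -/
lemma finrank_adjoin_pow [FiniteDimensional F V] [Nontrivial A] (h : IsPowerEnvelope φ f)
    (n : ℕ) :
    finrank F (Algebra.adjoin F (Set.range fun a : A => a ^ p ^ n)) =
      p ^ finrank F (Submodule.span F (Set.range φ^[n])) := by
  have : CharP A p := charP_of_injective_algebraMap (algebraMap F A).injective p
  rw [h.adjoin_pow_eq, h.finrank_adjoin]
  intro x hx
  induction hx using Submodule.span_induction with
  | mem x hx =>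
    obtain ⟨y, rfl⟩ := hx
    exact Submodule.subset_span ⟨φ y, by rw [← Function.iterate_succ_apply,
      Function.iterate_succ_apply']⟩
  | zero => simp
  | add x y _ _ hx hy =>
    rw [map_add]
    exact add_mem hx hy
  | smul a x _ hx =>
    rw [map_smulₛₗ]
    exact Submodule.smul_mem _ _ hx

end IsPowerEnvelope

end Envelope

section Frobenius

variable {F V A : Type*} [Field F] [AddCommGroup V] [Module F V]
  {p : ℕ} [Fact p.Prime] [CharP F p] [CommRing A] [Algebra F A]

lemma aeval_pow_char {ι : Type*} [CharP A p] (x : ι → A) (P : MvPolynomial ι F) :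
    aeval x P ^ p = aeval (fun i => x i ^ p) (map (frobenius F p) P) := by
  induction P using MvPolynomial.induction_on with
  | C r => simp [frobenius_def]
  | add P Q hP hQ => rw [map_add, add_pow_char, hP, hQ, map_add, map_add]
  | mul_X P i hP => simp only [map_mul, mul_pow, hP, aeval_X, map_X]

lemma map_mem_truncated {ι : Type*} {n : ℕ} (g : F →+* F) {P : MvPolynomial ι F}
    (hP : P ∈ truncated F ι n) : map g P ∈ truncated F ι n :=
  fun _ hm => hP (support_map_subset g P hm)

variable {φ : V →ₛₗ[frobenius F p] V} {f : V →ₗ[F] A}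

lemma linearIndependent_semilinear [PerfectRing F p] {ι W : Type*} [Finite ι] [AddCommGroup W]
    [Module F W] {g : V →ₛₗ[frobenius F p] W} (hg : Function.Injective g) {v : ι → V}
    (hv : LinearIndependent F v) : LinearIndependent F fun i => g (v i) := by
  cases nonempty_fintype ι
  rw [Fintype.linearIndependent_iff] at hv ⊢
  intro c hc i
  choose d hd using fun i => surjective_frobenius F p (c i)
  have h0 : g (∑ i, d i • v i) = 0 := by
    rw [map_sum, ← hc]
    exact Finset.sum_congr rfl fun j _ => by rw [map_smulₛₗ, hd]
  rw [← hd i, hv d (hg (h0.trans (map_zero g).symm)) i, map_zero]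

lemma IsPowerEnvelope.isReduced [PerfectRing F p] [FiniteDimensional F V] [Nontrivial A]
    (h : IsPowerEnvelope φ f) (hφ : Function.Injective φ) : IsReduced A := by
  have : CharP A p := charP_of_injective_algebraMap (algebraMap F A).injective p
  rw [isReduced_iff_pow_one_lt p (Fact.out : p.Prime).one_lt]
  intro a ha
  let b := finBasis F V
  have hli := linearIndependent_semilinear hφ b.linearIndependent
  let b' : Basis (Fin (finrank F V)) F V := Basis.mk hli
    (hli.span_eq_top_of_card_eq_finrank' (by simp)).ge
  have hb' : ∀ i, b' i = φ (b i) := fun i => Basis.mk_apply hli _ i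
  obtain ⟨P, hP, rfl⟩ := h.exists_truncated b a
  rw [aeval_pow_char] at ha
  simp only [h.pow_eq, ← hb'] at ha
  have h0 := h.eq_zero_of_mem_truncated b' (map_mem_truncated _ hP) ha
  rw [map_injective _ (frobenius F p).injective (h0.trans (map_zero _).symm), map_zero]

/-- If `φ` is injective, functionals commuting with the Frobenius separate points. -/
lemma exists_equivariant_functional [IsAlgClosed F] [PerfectRing F p] [FiniteDimensional F V]
    (hφ : Function.Injective φ) {x : V} (hx : x ≠ 0) :
    ∃ χ : V →ₗ[F] F, (∀ y, χ (φ y) = χ y ^ p) ∧ χ x ≠ 0 := by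
  let b := finBasis F V
  have h := isPowerEnvelope_toPowerQuotient φ b
  have := nontrivial_powerQuotient φ b
  have := h.isReduced hφ
  have := h.finite
  have hnil : ¬ IsNilpotent (toPowerQuotient φ b x) := fun hn =>
    hx (h.injective (hn.eq_zero.trans (map_zero _).symm))
  rw [nilpotent_iff_mem_prime] at hnil
  push Not at hnil
  obtain ⟨J, hJ, hxJ⟩ := hnil
  have hbij := IsAlgClosed.algebraMap_bijective_of_isIntegral (k := F) (K := PowerQuotient φ b ⧸ J)
  let e := AlgEquiv.ofBijective (Algebra.ofId F (PowerQuotient φ b ⧸ J)) hbij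
  let g : PowerQuotient φ b →ₐ[F] F := e.symm.toAlgHom.comp (Ideal.Quotient.mkₐ F J)
  refine ⟨g.toLinearMap ∘ₗ toPowerQuotient φ b, fun y => ?_, fun h0 => hxJ ?_⟩
  · simp [← h.pow_eq]
  · have : e.symm (Ideal.Quotient.mkₐ F J (toPowerQuotient φ b x)) = 0 := h0
    rw [map_eq_zero_iff _ e.symm.injective] at this
    exact Ideal.Quotient.eq_zero_iff_mem.1 this

/-- A bijective Frobenius-semilinear map over an algebraically closed field is the coordinatewise
Frobenius in suitable coordinates. -/
theorem exists_frobenius_coordinates [IsAlgClosed F] [PerfectRing F p] [FiniteDimensional F V]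
    (hφ : Function.Injective φ) :
    ∃ e : V ≃ₗ[F] (Fin (finrank F V) → F), ∀ x i, e (φ x) i = e x i ^ p := by
  let E : Set (Dual F V) := {χ | ∀ y, χ (φ y) = χ y ^ p}
  obtain ⟨s, hsE, hspan, hs⟩ := exists_linearIndependent F E
  have : Finite s := hs.finite
  cases nonempty_fintype s
  let g : V →ₗ[F] (s → F) := LinearMap.pi fun χ => χ.1
  have hg : Function.Injective g := by
    rw [← LinearMap.ker_eq_bot, LinearMap.ker_eq_bot']
    intro x hx
    by_contra hx0
    obtain ⟨χ, hχ, hχx⟩ := exists_equivariant_functional hφ hx0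
    have hle : Submodule.span F s ≤ LinearMap.ker (LinearMap.applyₗ (R := F) x) := by
      rw [Submodule.span_le]
      exact fun η hη => congrFun hx ⟨η, hη⟩
    exact hχx (hle (hspan ▸ Submodule.subset_span hχ))
  have hcard : Fintype.card s = finrank F V := by
    apply le_antisymm
    · rw [← Subspace.dual_finrank_eq]
      exact hs.fintype_card_le_finrank
    · simpa using LinearMap.finrank_le_finrank_of_injective hg
  let e := LinearEquiv.ofInjectiveOfFinrankEq g hg (by simp [hcard])
  let r := LinearEquiv.funCongrLeft F F (Fintype.equivFinOfCardEq hcard).symm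
  refine ⟨e.trans r, fun x i => ?_⟩
  exact hsE ((Fintype.equivFinOfCardEq hcard).symm i).2 x

end Frobenius

section Classification

variable {F V W : Type*} [Field F] [AddCommGroup V] [Module F V] [AddCommGroup W] [Module F W]
  {p : ℕ} [Fact p.Prime] [CharP F p]

lemma exists_relative_complement {A B : Submodule F V} (h : A ≤ B) :
    ∃ C ≤ B, A ⊓ C = ⊥ ∧ A ⊔ C = B := by
  obtain ⟨Q, hQ⟩ := A.exists_isCompl
  refine ⟨Q ⊓ B, inf_le_right, ?_, ?_⟩
  · rw [← inf_assoc, hQ.inf_eq_bot, bot_inf_eq]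
  · rw [← sup_inf_assoc_of_le Q h, hQ.sup_eq_top, top_inf_eq]

variable [PerfectRing F p]

instance : RingHomSurjective (frobenius F p) := ⟨surjective_frobenius F p⟩

lemma finrank_range_add_finrank_ker [FiniteDimensional F V] (φ : V →ₛₗ[frobenius F p] V) :
    finrank F (LinearMap.range φ) + finrank F (LinearMap.ker φ) = finrank F V := by
  obtain ⟨Q, hQ⟩ := (LinearMap.ker φ).exists_isCompl
  let g : Q →+ LinearMap.range φ :=
    { toFun := fun x => ⟨φ x, x, rfl⟩
      map_zero' := by ext; simp
      map_add' := fun x y => by ext; simp }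
  have hg : Function.Bijective g := by
    constructor
    · rw [injective_iff_map_eq_zero]
      intro x hx
      have hx' : (x : V) ∈ LinearMap.ker φ ⊓ Q := ⟨congrArg Subtype.val hx, x.2⟩
      rw [hQ.inf_eq_bot] at hx'
      exact Subtype.ext hx'
    · rintro ⟨_, x, rfl⟩
      have hx : x ∈ LinearMap.ker φ ⊔ Q := hQ.sup_eq_top ▸ Submodule.mem_top
      obtain ⟨k, hk, q, hq, rfl⟩ := Submodule.mem_sup.1 hx
      refine ⟨⟨q, hq⟩, Subtype.ext ?_⟩
      simp [g, LinearMap.mem_ker.1 hk]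
  have hrank := rank_eq_of_equiv_equiv (frobenius F p) (AddEquiv.ofBijective g hg)
    ⟨(frobenius F p).injective, surjective_frobenius F p⟩ (fun r x => by
      refine Subtype.ext ?_
      exact map_smulₛₗ φ r (x : V))
  have hfin : finrank F Q = finrank F (LinearMap.range φ) := congrArg Cardinal.toNat hrank
  rw [← hfin, add_comm]
  exact Submodule.finrank_add_eq_of_isCompl hQ

/-- An equivariant isomorphism between the images of `φ` and `ψ` extends to the whole spaces. -/
lemma exists_extend_equivariant [FiniteDimensional F V] [FiniteDimensional F W]
    {φ : V →ₛₗ[frobenius F p] V} {ψ : W →ₛₗ[frobenius F p] W}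
    (hVW : finrank F V = finrank F W)
    (e₁ : LinearMap.range φ ≃ₗ[F] LinearMap.range ψ)
    (he₁ : ∀ y : LinearMap.range φ, (e₁ ⟨φ y, y, rfl⟩ : W) = ψ (e₁ y)) :
    ∃ e : V ≃ₗ[F] W, ∀ x, e (φ x) = ψ (e x) := by
  let M := LinearMap.range φ
  let K := LinearMap.ker φ
  let ε : M →ₗ[F] W := (LinearMap.range ψ).subtype ∘ₗ e₁.toLinearMap
  have hε : Function.Injective ε := Subtype.val_injective.comp e₁.injective
  let φ' : V →ₛₗ[frobenius F p] M := φ.rangeRestrict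
  have hεφ : ∀ y : M, ε (φ' y) = ψ (ε y) := he₁
  -- a lift of `ε ∘ φ` through `ψ` which restricts to `ε`
  obtain ⟨N, hMN⟩ := M.exists_isCompl
  have hlift : ∀ x, ∃ w, ψ w = ε (φ' x) := fun x => (e₁ (φ' x)).2
  choose w hw using hlift
  let bN := finBasis F N
  let e' : V →ₗ[F] W := LinearMap.ofIsCompl hMN ε (bN.constr F fun j => w (bN j))
  have he'M : ∀ m : M, e' m = ε m := fun m => LinearMap.ofIsCompl_apply_left hMN m
  have he' : ∀ x, ψ (e' x) = ε (φ' x) := by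
    have hN : (ψ.comp e').comp N.subtype = (ε.comp φ').comp N.subtype := by
      refine bN.ext fun j => ?_
      have : e' (bN j) = w (bN j) := by
        rw [LinearMap.ofIsCompl_apply_right hMN (bN j), bN.constr_basis]
      simp [this, hw]
    intro x
    have hx : x ∈ M ⊔ N := hMN.sup_eq_top ▸ Submodule.mem_top
    obtain ⟨m, hm, n, hn, rfl⟩ := Submodule.mem_sup.1 hx
    have hn' := LinearMap.congr_fun hN ⟨n, hn⟩
    simp only [LinearMap.comp_apply, Submodule.subtype_apply] at hn'
    rw [map_add, map_add, map_add, map_add, hn', he'M ⟨m, hm⟩, ← hεφ ⟨m, hm⟩]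
  -- complements of the part of the kernels lying in the images
  obtain ⟨C, hCK, hC, hC'⟩ := exists_relative_complement (inf_le_left : K ⊓ M ≤ K)
  let J : Submodule F W := ((K ⊓ M).comap M.subtype).map ε
  have hJ : J ≤ LinearMap.ker ψ := by
    rintro _ ⟨m, hm, rfl⟩
    rw [LinearMap.mem_ker, ← hεφ]
    have : φ' m = 0 := Subtype.ext hm.1
    rw [this, map_zero]
  obtain ⟨D, hDK, hD, hD'⟩ := exists_relative_complement hJ
  have hrank : finrank F M = finrank F (LinearMap.range ψ) := e₁.finrank_eq
  have hCD : finrank F C = finrank F D := by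
    have h1 : finrank F M + finrank F K = _ := finrank_range_add_finrank_ker φ
    have h2 := finrank_range_add_finrank_ker ψ
    have h3 := Submodule.finrank_sup_add_finrank_inf_eq (K ⊓ M) C
    have h4 := Submodule.finrank_sup_add_finrank_inf_eq J D
    have h5 : finrank F J = finrank F ((K ⊓ M : Submodule F V).comap M.subtype) :=
      (Submodule.equivMapOfInjective ε hε _).symm.finrank_eq
    have h6 : finrank F ((K ⊓ M : Submodule F V).comap M.subtype) =
        finrank F (K ⊓ M : Submodule F V) :=
      (Submodule.comapSubtypeEquivOfLe inf_le_right).finrank_eq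
    rw [hC, hC', finrank_bot] at h3
    rw [hD, hD', finrank_bot] at h4
    omega
  let c : C ≃ₗ[F] D := LinearEquiv.ofFinrankEq C D hCD
  have hCM : C ⊓ M = ⊥ := by
    rw [eq_bot_iff, ← hC]
    exact fun x hx => ⟨⟨hCK hx.1, hx.2⟩, hx.1⟩
  obtain ⟨r₀, hr₀⟩ := (M.mkQ ∘ₗ C.subtype).exists_leftInverse_of_injective (by
    rw [LinearMap.ker_eq_bot']
    intro x hx
    have : (x : V) ∈ C ⊓ M := ⟨x.2, (Submodule.Quotient.mk_eq_zero M).1 hx⟩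
    rw [hCM] at this
    exact Subtype.ext this)
  let r : V →ₗ[F] C := r₀ ∘ₗ M.mkQ
  have hrM : ∀ m : M, r m = 0 := fun m => by
    have : M.mkQ (m : V) = 0 := (Submodule.Quotient.mk_eq_zero M).2 m.2
    simp only [r, LinearMap.comp_apply, this, map_zero]
  have hrC : ∀ y : C, r y = y := fun y => LinearMap.congr_fun hr₀ y
  let e : V →ₗ[F] W := e' + (D.subtype ∘ₗ c.toLinearMap - e' ∘ₗ C.subtype) ∘ₗ r
  have he_apply : ∀ x, e x = e' x + ((c (r x) : W) - e' (r x)) := fun x => rfl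
  have heM : ∀ m : M, e m = ε m := fun m => by rw [he_apply, hrM, he'M]; simp
  have heC : ∀ y : C, e y = c y := fun y => by rw [he_apply, hrC]; abel
  have heψ : ∀ x, ψ (e x) = ε (φ' x) := by
    intro x
    have h1 : ψ (c (r x)) = 0 := hDK (c (r x)).2
    have h2 : φ' (r x) = 0 := Subtype.ext (hCK (r x).2)
    rw [he_apply, map_add, map_sub, he', he', h1, h2]
    simp
  have hinj : Function.Injective e := by
    rw [← LinearMap.ker_eq_bot, LinearMap.ker_eq_bot']
    intro x hx
    have hφx : φ' x = 0 := hε (by rw [← heψ, hx, map_zero, map_zero])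
    have hxK : x ∈ K ⊓ M ⊔ C := by
      rw [hC']
      exact congrArg Subtype.val hφx
    obtain ⟨k, hk, y, hy, rfl⟩ := Submodule.mem_sup.1 hxK
    rw [map_add, heM ⟨k, hk.2⟩, heC ⟨y, hy⟩] at hx
    have hεk : ε ⟨k, hk.2⟩ ∈ J := ⟨⟨k, hk.2⟩, hk, rfl⟩
    have hmem : (c ⟨y, hy⟩ : W) ∈ J ⊓ D := by
      refine ⟨?_, (c ⟨y, hy⟩).2⟩
      rw [← neg_eq_of_add_eq_zero_right hx]
      exact neg_mem hεk
    rw [hD, Submodule.mem_bot] at hmem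
    rw [hmem, add_zero] at hx
    have hk0 : k = 0 := congrArg Subtype.val (hε (hx.trans (map_zero ε).symm))
    have hy0 : y = 0 := congrArg Subtype.val (c.injective ((Subtype.ext hmem).trans
      (map_zero c).symm))
    rw [hk0, hy0, add_zero]
  refine ⟨LinearEquiv.ofInjectiveOfFinrankEq e hinj hVW, fun x => ?_⟩
  exact (heM (φ' x)).trans (heψ x).symm

/-- Restriction of `φ` to its image. -/
def restrictRange (φ : V →ₛₗ[frobenius F p] V) :
    LinearMap.range φ →ₛₗ[frobenius F p] LinearMap.range φ :=
  φ.rangeRestrict.comp (LinearMap.range φ).subtype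

lemma finrank_span_restrictRange (φ : V →ₛₗ[frobenius F p] V) (k : ℕ) :
    finrank F (Submodule.span F (Set.range (restrictRange φ)^[k])) =
      finrank F (Submodule.span F (Set.range φ^[k + 1])) := by
  have hsemi : ∀ y, ((restrictRange φ)^[k] y : V) = φ^[k] y := fun y =>
    (Function.Semiconj.iterate_right (f := Subtype.val) (fun _ => rfl) k) y
  have : (Submodule.span F (Set.range (restrictRange φ)^[k])).map (LinearMap.range φ).subtype =
      Submodule.span F (Set.range φ^[k + 1]) := by
    rw [Submodule.map_span, ← Set.range_comp]
    congr 1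
    ext v
    constructor
    · rintro ⟨⟨_, x, rfl⟩, rfl⟩
      exact ⟨x, (hsemi ⟨φ x, x, rfl⟩).symm⟩
    · rintro ⟨x, rfl⟩
      exact ⟨⟨φ x, x, rfl⟩, hsemi _⟩
  rw [← this]
  exact (Submodule.equivMapOfInjective _ Subtype.val_injective _).finrank_eq

/-- Over an algebraically closed field, a Frobenius-semilinear endomorphism is determined by the
ranks of its iterates. -/
theorem exists_equivariant_equiv [IsAlgClosed F] [FiniteDimensional F V] [FiniteDimensional F W]
    (φ : V →ₛₗ[frobenius F p] V) (ψ : W →ₛₗ[frobenius F p] W)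
    (h : ∀ k, finrank F (Submodule.span F (Set.range φ^[k])) =
      finrank F (Submodule.span F (Set.range ψ^[k]))) :
    ∃ e : V ≃ₗ[F] W, ∀ x, e (φ x) = ψ (e x) := by
  induction hn : finrank F V using Nat.strong_induction_on generalizing V W with
  | _ n ih =>
    subst hn
    have hVW : finrank F V = finrank F W := by
      have h0 := h 0
      rw [Function.iterate_zero, Function.iterate_zero, Set.range_id, Set.range_id,
        Submodule.span_univ, Submodule.span_univ, finrank_top, finrank_top] at h0
      exact h0
    have h1 : finrank F (LinearMap.range φ) = finrank F (LinearMap.range ψ) := by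
      have h1 := h 1
      rw [Function.iterate_one, Function.iterate_one, ← LinearMap.coe_range, ← LinearMap.coe_range,
        Submodule.span_eq, Submodule.span_eq] at h1
      exact h1
    by_cases hM : finrank F (LinearMap.range φ) < finrank F V
    · obtain ⟨e₁, he₁⟩ := ih _ hM (restrictRange φ) (restrictRange ψ) (fun k => by
        rw [finrank_span_restrictRange, finrank_span_restrictRange, h]) rfl
      exact exists_extend_equivariant hVW e₁ fun y => congrArg Subtype.val (he₁ y)
    · have hV := finrank_range_add_finrank_ker φ
      have hW := finrank_range_add_finrank_ker ψ
      have hφ : Function.Injective φ := by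
        rw [← LinearMap.ker_eq_bot]
        exact Submodule.finrank_eq_zero.1 (by omega)
      have hψ : Function.Injective ψ := by
        rw [← LinearMap.ker_eq_bot]
        exact Submodule.finrank_eq_zero.1 (by omega)
      obtain ⟨e, he⟩ := exists_frobenius_coordinates hφ
      obtain ⟨e', he'⟩ := exists_frobenius_coordinates hψ
      refine ⟨e.trans ((LinearEquiv.funCongrLeft F F (finCongr hVW.symm)).trans e'.symm),
        fun x => e'.injective (funext fun i => ?_)⟩
      rw [he']
      simp [LinearEquiv.funCongrLeft_apply, LinearMap.funLeft_apply, he]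

end Classification

section Twist

variable {F V κ : Type*} [Field F] [AddCommGroup V] [Module F V]

/-- The derivation of the polynomial ring acting on linear forms by an endomorphism. -/
noncomputable def linDerivation (b : Basis κ F V) (g : V →ₗ[F] V) :
    Derivation F (MvPolynomial κ F) (MvPolynomial κ F) :=
  mkDerivation F fun j => linForm b (g (b j))

lemma linDerivation_X (b : Basis κ F V) (g : V →ₗ[F] V) (j : κ) :
    linDerivation b g (X j) = linForm b (g (b j)) :=
  mkDerivation_X F _ j

lemma linDerivation_linForm (b : Basis κ F V) (g : V →ₗ[F] V) (x : V) :
    linDerivation b g (linForm b x) = linForm b (g x) := by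
  have : (linDerivation b g).toLinearMap ∘ₗ linForm b = linForm b ∘ₗ g :=
    b.ext fun j => by simp [linDerivation_X]
  exact LinearMap.congr_fun this x

lemma derivation_iterate_mul_X (D : Derivation F (MvPolynomial κ F) (MvPolynomial κ F))
    (hD : ∀ j, D (D (X j)) = 0) (n : ℕ) (f : MvPolynomial κ F) (j : κ) :
    D^[n + 1] (f * X j) = D^[n + 1] f * X j + (n + 1 : ℕ) • (D^[n] f * D (X j)) := by
  induction n with
  | zero => simp [mul_comm, add_comm]
  | succ n ih =>
    rw [Function.iterate_succ_apply', ih, map_add, map_nsmul, D.leibniz, D.leibniz, hD,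
      ← Function.iterate_succ_apply' D, ← Function.iterate_succ_apply' D]
    simp only [smul_eq_mul, nsmul_eq_mul]
    push_cast
    ring

lemma derivation_iterate_char {p : ℕ} [Fact p.Prime] [CharP F p]
    (D : Derivation F (MvPolynomial κ F) (MvPolynomial κ F))
    (hD : ∀ j, D (D (X j)) = 0) (f : MvPolynomial κ F) : D^[p] f = 0 := by
  obtain ⟨n, hn⟩ := Nat.exists_eq_succ_of_ne_zero (Fact.out : p.Prime).ne_zero
  have hzero : ∀ m, D^[m] 0 = 0 := fun m => Function.iterate_fixed (map_zero D) m
  induction f using MvPolynomial.induction_on with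
  | C r =>
    rw [hn, Function.iterate_succ_apply, ← algebraMap_eq, D.map_algebraMap, hzero]
  | add f g hf hg => rw [iterate_map_add, hf, hg, add_zero]
  | mul_X f j hf =>
    rw [hn, Nat.succ_eq_add_one] at hf ⊢
    rw [derivation_iterate_mul_X D hD, hf, ← Nat.succ_eq_add_one, ← hn, nsmul_eq_mul,
      CharP.cast_eq_zero, zero_mul, zero_mul, add_zero]

variable (b : Basis κ F V) (β : V →ₗ[F] V →ₗ[F] V)

/-- Multiplication by a linear form, twisted by the derivation attached to `β x`. -/
noncomputable def twistedMul (x : V) : Module.End F (MvPolynomial κ F) :=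
  LinearMap.mulLeft F (linForm b x) + (linDerivation b (β x)).toLinearMap

lemma twistedMul_apply (x : V) (f : MvPolynomial κ F) :
    twistedMul b β x f = linForm b x * f + linDerivation b (β x) f := rfl

variable {b β}

lemma linDerivation_zero : linDerivation b (0 : V →ₗ[F] V) = 0 :=
  derivation_ext fun j => by simp [linDerivation_X]

lemma twistedMul_add (x y : V) : twistedMul b β (x + y) = twistedMul b β x + twistedMul b β y := by
  have : linDerivation b (β (x + y)) = linDerivation b (β x) + linDerivation b (β y) :=
    derivation_ext fun j => by simp [linDerivation_X]
  refine LinearMap.ext fun f => ?_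
  rw [twistedMul_apply, this]
  simp only [twistedMul_apply, LinearMap.add_apply, map_add, Derivation.add_apply]
  ring

lemma twistedMul_smul (c : F) (x : V) : twistedMul b β (c • x) = c • twistedMul b β x := by
  have : linDerivation b (β (c • x)) = c • linDerivation b (β x) :=
    derivation_ext fun j => by simp [linDerivation_X]
  refine LinearMap.ext fun f => ?_
  rw [twistedMul_apply, this]
  simp [twistedMul_apply]

lemma twistedMul_of_eq_zero {x : V} (hx : β x = 0) (f : MvPolynomial κ F) :
    twistedMul b β x f = linForm b x * f := by
  rw [twistedMul_apply, hx, linDerivation_zero, Derivation.zero_apply, add_zero]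

lemma linDerivation_comm (hβ : ∀ x y w, β w (β x y) = 0) (x y : V) (f : MvPolynomial κ F) :
    linDerivation b (β x) (linDerivation b (β y) f) =
      linDerivation b (β y) (linDerivation b (β x) f) := by
  have : ⁅linDerivation b (β x), linDerivation b (β y)⁆ = 0 := derivation_ext fun j => by
    rw [Derivation.commutator_apply]
    simp [linDerivation_X, linDerivation_linForm, hβ]
  have h := congrArg (fun D => D f) this
  rw [Derivation.commutator_apply] at h
  exact sub_eq_zero.1 h

lemma twistedMul_commutator (hβ : ∀ x y w, β w (β x y) = 0) (x y : V) (f : MvPolynomial κ F) :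
    twistedMul b β x (twistedMul b β y f) - twistedMul b β y (twistedMul b β x f) =
      linForm b (β x y - β y x) * f := by
  simp only [twistedMul_apply, map_add, Derivation.leibniz, smul_eq_mul, linDerivation_linForm,
    map_sub, linDerivation_comm hβ x y f]
  ring

lemma twistedMul_pow {p : ℕ} [Fact p.Prime] [CharP F p] (hβ : ∀ x y w, β w (β x y) = 0) {x : V}
    (hx : β x x = 0) (f : MvPolynomial κ F) :
    (twistedMul b β x ^ p) f = linForm b x ^ p * f := by
  have : CharP (Module.End F (MvPolynomial κ F)) p :=
    charP_of_injective_algebraMap (algebraMap F _).injective p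
  have hcomm : Commute (LinearMap.mulLeft F (linForm b x))
      (linDerivation b (β x)).toLinearMap := by
    refine LinearMap.ext fun f => ?_
    simp [linDerivation_linForm, hx]
  rw [twistedMul, add_pow_char_of_commute _ hcomm, LinearMap.add_apply, LinearMap.pow_mulLeft,
    LinearMap.mulLeft_apply, Module.End.pow_apply]
  have hD := derivation_iterate_char (p := p) (linDerivation b (β x))
    (fun j => by rw [linDerivation_X, linDerivation_linForm, hβ, map_zero]) f
  exact (congrArg _ hD).trans (add_zero _)

lemma twistedMul_mem_relIdeal {p : ℕ} [CharP F p] {l : κ → V} (hl : ∀ x i, β x (l i) = 0) (x : V)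
    {f : MvPolynomial κ F} (hf : f ∈ relIdeal p fun i => linForm b (l i)) :
    twistedMul b β x f ∈ relIdeal p fun i => linForm b (l i) := by
  rw [twistedMul_apply]
  refine add_mem (Ideal.mul_mem_left _ _ hf) ?_
  rw [relIdeal] at hf
  induction hf using Submodule.span_induction with
  | mem f hf =>
    obtain ⟨i, rfl⟩ := hf
    simp only [map_sub, Derivation.leibniz_pow, linDerivation_linForm, hl, map_zero, sub_zero]
    rw [← Nat.cast_smul_eq_nsmul F, CharP.cast_eq_zero, zero_smul]
    exact zero_mem _
  | zero => simp
  | add f g _ _ hf hg =>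
    rw [map_add]
    exact add_mem hf hg
  | smul a f hf hf' =>
    rw [smul_eq_mul, Derivation.leibniz]
    exact add_mem (Ideal.mul_mem_left _ _ hf') (Ideal.mul_mem_right _ _ hf)

end Twist

end TruncatedPolynomial

namespace RestrictedLieAlgebra

open MvPolynomial Module TruncatedPolynomial

universe u

variable (p : ℕ) {F : Type*} {H : Type u} [Field F] [LieRing H] [LieAlgebra F H]
  [RestrictedLieAlgebra p F H]

section Lift

variable {A : Type*} [Ring A] [Algebra F A]

/-- It suffices to check on a basis that a representation is restricted. -/
lemma map_pmap_of_basis {κ : Type*} (hp : p ≠ 0) (b : Basis κ F H) (ρ : H →ₗ⁅F⁆ A)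
    (hρ : ∀ i, ρ (b i) ^ p = ρ (pmap p F H (b i))) (x : H) : ρ x ^ p = ρ (pmap p F H x) := by
  have hsmul : ∀ (a : F) (x : H), ρ x ^ p = ρ (pmap p F H x) →
      ρ (a • x) ^ p = ρ (pmap p F H (a • x)) := by
    intro a x hx
    have h : pmap p F H (a • x) = a ^ p • pmap p F H x := RestrictedLieAlgebra.pOp_smul a x
    rw [h, map_smul, map_smul, smul_pow, hx]
  have hx : x ∈ Submodule.span F (Set.range b) := by
    rw [b.span_eq]
    exact Submodule.mem_top
  induction hx using Submodule.span_induction with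
  | mem x hx =>
    obtain ⟨i, rfl⟩ := hx
    exact hρ i
  | zero =>
    have h : pmap p F H (0 : H) = 0 := by
      have h := RestrictedLieAlgebra.pOp_smul (p := p) (0 : F) (0 : H)
      rwa [zero_smul, zero_pow hp, zero_smul] at h
    rw [h, map_zero, zero_pow hp]
  | add x y _ _ hx hy =>
    have h := congrArg (UniversalEnvelopingAlgebra.lift F ρ)
      (RestrictedLieAlgebra.pOp_add (p := p) (F := F) x y)
    simp only [map_sub, map_add, map_pow, UniversalEnvelopingAlgebra.lift_ι_apply] at h
    rw [hx, hy, sub_left_inj, sub_left_inj] at h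
    rw [map_add]
    exact h.symm
  | smul a x _ hx => exact hsmul a x hx

/-- The algebra map out of `u(H)` attached to a restricted representation. -/
noncomputable def uLift (ρ : H →ₗ⁅F⁆ A) (hρ : ∀ x, ρ x ^ p = ρ (pmap p F H x)) :
    uEnv p F H →ₐ[F] A :=
  RingQuot.liftAlgHom F ⟨UniversalEnvelopingAlgebra.lift F ρ, by
    rintro a b ⟨x, rfl, rfl⟩
    simp only [map_pow, UniversalEnvelopingAlgebra.lift_ι_apply]
    exact hρ x⟩

lemma uLift_uemb (ρ : H →ₗ⁅F⁆ A) (hρ : ∀ x, ρ x ^ p = ρ (pmap p F H x)) (x : H) :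
    uLift p ρ hρ (uemb p F H x) = ρ x := by
  change RingQuot.liftAlgHom F _ (RingQuot.mkAlgHom F (uRel p F H) (ι F x)) = ρ x
  rw [RingQuot.liftAlgHom_mkAlgHom_apply, UniversalEnvelopingAlgebra.lift_ι_apply]

lemma uemb_lie (x y : H) :
    uemb p F H ⁅x, y⁆ = uemb p F H x * uemb p F H y - uemb p F H y * uemb p F H x := by
  change RingQuot.mkAlgHom F (uRel p F H) (ι F ⁅x, y⁆) = _
  rw [LieHom.map_lie, LieRing.of_associative_ring_bracket, map_sub, map_mul, map_mul]
  rfl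

lemma uemb_pow (x : H) : uemb p F H x ^ p = uemb p F H (pmap p F H x) := by
  change RingQuot.mkAlgHom F (uRel p F H) (ι F x) ^ p = _
  rw [← map_pow]
  exact RingQuot.mkAlgHom_rel F ⟨x, rfl, rfl⟩

lemma adjoin_range_uemb : Algebra.adjoin F (Set.range (uemb p F H)) = ⊤ := by
  have hι : Algebra.adjoin F (Set.range (ι F : H → UniversalEnvelopingAlgebra F H)) = ⊤ := by
    have h : (UniversalEnvelopingAlgebra.mkAlgHom F H).range = ⊤ :=
      (AlgHom.range_eq_top _).2 fun a => Quot.exists_rep a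
    rw [← h, ← Algebra.map_top, ← TensorAlgebra.adjoin_range_ι, AlgHom.map_adjoin, ← Set.range_comp]
    rfl
  have h : (RingQuot.mkAlgHom F (uRel p F H)).range = ⊤ :=
    (AlgHom.range_eq_top _).2 (RingQuot.mkAlgHom_surjective F _)
  rw [← h, ← Algebra.map_top, ← hι, AlgHom.map_adjoin, ← Set.range_comp]
  rfl

end Lift

/-- A bilinear form splitting the bracket of a Lie algebra of class at most two. -/
lemma exists_bracket_splitting (hH : ∀ x y w : H, ⁅⁅x, y⁆, w⁆ = 0) :
    ∃ (κ : Type u) (b : Basis κ F H) (β : H →ₗ[F] H →ₗ[F] H),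
      (∀ x y, β x y - β y x = ⁅x, y⁆) ∧ (∀ z, (∀ y : H, ⁅z, y⁆ = 0) → β z = 0) ∧
      (∀ z, (∀ y : H, ⁅z, y⁆ = 0) → ∀ x, β x z = 0) ∧ (∀ x y (w : H), ⁅β x y, w⁆ = 0) ∧
      ∀ i, β (b i) (b i) = 0 := by
  classical
  let Z : Submodule F H := LinearMap.ker (LieAlgebra.ad F H : H →ₗ[F] Module.End F H)
  have hZ : ∀ {z}, z ∈ Z ↔ ∀ y : H, ⁅z, y⁆ = 0 := fun {z} =>
    LinearMap.ext_iff (f := LieAlgebra.ad F H z) (g := 0)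
  obtain ⟨Z', hZZ'⟩ := Z.exists_isCompl
  let bZ := Basis.ofVectorSpace F Z
  let b := (bZ.prod (Basis.ofVectorSpace F Z')).map (Z.prodEquivOfIsCompl Z' hZZ')
  have hb : ∀ k, b (Sum.inl k) = bZ k := fun k => by simp [b]
  let _ : LinearOrder (Basis.ofVectorSpaceIndex F Z ⊕ Basis.ofVectorSpaceIndex F Z') :=
    linearOrderOfSTO WellOrderingRel
  let β : H →ₗ[F] H →ₗ[F] H :=
    b.constr F fun i => b.constr F fun j => if i < j then ⁅b i, b j⁆ else 0
  have hβ : ∀ i j, β (b i) (b j) = if i < j then ⁅b i, b j⁆ else 0 := fun i j => by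
    simp only [β, Basis.constr_basis]
  have hleft : ∀ z ∈ Z, β z = 0 := by
    have h : β ∘ₗ Z.subtype = 0 := bZ.ext fun k => b.ext fun j => by
      have hk : ⁅b (Sum.inl k), b j⁆ = 0 := by
        rw [hb]
        exact hZ.1 (bZ k).2 _
      have := hβ (Sum.inl k) j
      rw [hk, ite_self, hb] at this
      exact this
    exact fun z hz => LinearMap.congr_fun h ⟨z, hz⟩
  have hright : ∀ z ∈ Z, β.flip z = 0 := by
    have h : β.flip ∘ₗ Z.subtype = 0 := bZ.ext fun k => b.ext fun j => by
      have hk : ⁅b j, b (Sum.inl k)⁆ = 0 := by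
        rw [hb, ← lie_skew, hZ.1 (bZ k).2, neg_zero]
      have := hβ j (Sum.inl k)
      rw [hk, ite_self, hb] at this
      exact this
    exact fun z hz => LinearMap.congr_fun h ⟨z, hz⟩
  refine ⟨_, b, β, fun x y => ?_, fun z hz => hleft z (hZ.2 hz),
    fun z hz x => LinearMap.congr_fun (hright z (hZ.2 hz)) x, fun x y => hZ.1 ?_, fun i => ?_⟩
  · have h : β - β.flip = (LieAlgebra.ad F H : H →ₗ[F] Module.End F H) :=
      b.ext fun i => b.ext fun j => by
        simp only [LinearMap.sub_apply, LinearMap.flip_apply, hβ]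
        rcases lt_trichotomy i j with hij | rfl | hij
        · simp [hij, hij.not_gt]
        · simp
        · simp [hij, hij.not_gt]
    exact LinearMap.congr_fun (LinearMap.congr_fun h x) y
  · have h : β.compr₂ Z.mkQ = 0 := b.ext fun i => b.ext fun j => by
      simp only [LinearMap.compr₂_apply, LinearMap.zero_apply, hβ, Submodule.mkQ_apply,
        Submodule.Quotient.mk_eq_zero]
      split_ifs
      · exact hZ.2 (hH _ _)
      · exact zero_mem _
    exact (Submodule.Quotient.mk_eq_zero Z).1 (LinearMap.congr_fun (LinearMap.congr_fun h x) y)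
  · rw [hβ, if_neg (lt_irrefl i)]

variable [Fact p.Prime] [CharP F p]

/-- The embedding into `u(H)` is injective for Lie algebras of class at most two. -/
theorem uemb_injective (hH : ∀ x y w : H, ⁅⁅x, y⁆, w⁆ = 0) : Function.Injective (uemb p F H) := by
  have hp : p.Prime := Fact.out
  obtain ⟨κ, b, β, hbr, hleft, hright, hcent, hdiag⟩ := exists_bracket_splitting (F := F) hH
  have hpmap : ∀ x y : H, ⁅pmap p F H x, y⁆ = 0 := by
    intro x y
    have h := RestrictedLieAlgebra.ad_pOp (p := p) (F := F) x y
    obtain ⟨n, hn⟩ := Nat.exists_eq_add_of_le hp.two_le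
    rw [h, hn, add_comm, pow_add, pow_two, Module.End.mul_apply, Module.End.mul_apply,
      LieAlgebra.ad_apply, LieAlgebra.ad_apply, ← lie_skew x, hH, neg_zero, map_zero]
  have hβ : ∀ x y w, β w (β x y) = 0 := fun x y w => hright _ (hcent x y) w
  have hlie : ∀ x y, β ⁅x, y⁆ = 0 := fun x y => hleft _ (hH x y)
  let I := relIdeal p fun i => linForm b (pmap p F H (b i))
  let N : Submodule F (MvPolynomial κ F) := I.restrictScalars F
  have hmem : ∀ x, N ≤ N.comap (twistedMul b β x) := fun x f hf =>
    twistedMul_mem_relIdeal (fun x i => hright _ (hpmap (b i)) x) x hf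
  let ρ : H →ₗ⁅F⁆ Module.End F (MvPolynomial κ F ⧸ N) :=
    { toFun := fun x => N.mapQ N (twistedMul b β x) (hmem x)
      map_add' := fun x y => Submodule.linearMap_qext _ <| LinearMap.ext fun f => by
        simp [twistedMul_add]
      map_smul' := fun c x => Submodule.linearMap_qext _ <| LinearMap.ext fun f => by
        simp [twistedMul_smul]
      map_lie' := fun {x y} => Submodule.linearMap_qext _ <| LinearMap.ext fun f => by
        rw [LieRing.of_associative_ring_bracket]
        simp only [LinearMap.comp_apply, LinearMap.sub_apply, Module.End.mul_apply,
          Submodule.mkQ_apply, Submodule.mapQ_apply, ← Submodule.Quotient.mk_sub,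
          twistedMul_commutator hβ, twistedMul_of_eq_zero (hlie x y), hbr] }
  have hρ : ∀ x f, ρ x (N.mkQ f) = N.mkQ (twistedMul b β x f) := fun x f => rfl
  have hρpow : ∀ (n : ℕ) x f, (ρ x ^ n) (N.mkQ f) = N.mkQ ((twistedMul b β x ^ n) f) := by
    intro n x f
    induction n with
    | zero => rfl
    | succ n ih => rw [pow_succ', pow_succ', Module.End.mul_apply, ih, hρ, Module.End.mul_apply]
  have hres := map_pmap_of_basis p hp.ne_zero b ρ fun i =>
    Submodule.linearMap_qext _ <| LinearMap.ext fun f => by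
      rw [LinearMap.comp_apply, LinearMap.comp_apply, hρpow, hρ, twistedMul_pow hβ (hdiag i),
        twistedMul_of_eq_zero (hleft _ (hpmap (b i))), linForm_basis, ← sub_eq_zero, ← map_sub,
        ← sub_mul]
      exact (Submodule.Quotient.mk_eq_zero N).2
        (Ideal.mul_mem_right _ I (X_pow_sub_mem_relIdeal p _ i))
  rw [← LinearMap.ker_eq_bot, LinearMap.ker_eq_bot']
  intro x hx
  have h := uLift_uemb p ρ hres x
  rw [hx, map_zero] at h
  have h1 : N.mkQ (linForm b x) = 0 := by
    have h1 := LinearMap.congr_fun h (N.mkQ 1)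
    rw [hρ, twistedMul_apply, Derivation.map_one_eq_zero, mul_one, add_zero] at h1
    exact h1.symm
  refine linForm_injective b ?_
  rw [map_zero]
  exact eq_zero_of_mem_truncated_of_mem_relIdeal hp.pos
    (fun i => linForm_mem_degreeLT b hp.two_le _) (linForm_mem_truncated b hp.two_le x)
    ((Submodule.Quotient.mk_eq_zero N).1 h1)

/-- A restricted Lie algebra with commutative restricted enveloping algebra is abelian. -/
theorem isLieAbelian_of_uEnv_comm (hcomm : ∀ a b : uEnv p F H, a * b = b * a) :
    IsLieAbelian H := by
  have hres : ∀ x : H, LieAlgebra.ad F H x ^ p = LieAlgebra.ad F H (pmap p F H x) := fun x =>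
    LinearMap.ext fun y => (RestrictedLieAlgebra.ad_pOp x y).symm
  have hclass : ∀ x y w : H, ⁅⁅x, y⁆, w⁆ = 0 := by
    intro x y w
    have h := congrArg (uLift p (LieAlgebra.ad F H) hres) (hcomm (uemb p F H x) (uemb p F H y))
    rw [map_mul, map_mul, uLift_uemb, uLift_uemb] at h
    have hw := LinearMap.congr_fun h w
    rw [lie_lie, sub_eq_zero]
    exact hw
  refine ⟨fun x y => uemb_injective p (F := F) hclass ?_⟩
  rw [uemb_lie, hcomm, sub_self, map_zero]

end RestrictedLieAlgebra

namespace RestrictedLieAlgebra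

open MvPolynomial Module TruncatedPolynomial

variable (p : ℕ) (F H : Type*) [Field F] [LieRing H] [LieAlgebra F H] [RestrictedLieAlgebra p F H]

lemma uEnv_mul_comm [IsLieAbelian H] (a b : uEnv p F H) : a * b = b * a := by
  have htop : ∀ c : uEnv p F H, c ∈ Algebra.adjoin F (Set.range (uemb p F H)) := fun c => by
    rw [adjoin_range_uemb]
    exact Algebra.mem_top
  refine Algebra.commute_of_mem_adjoin_of_forall_mem_commute (htop b) ?_
  rintro _ ⟨y, rfl⟩
  refine (Algebra.commute_of_mem_adjoin_of_forall_mem_commute (htop a) ?_).symm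
  rintro _ ⟨x, rfl⟩
  have h := uemb_lie p (F := F) y x
  rw [trivial_lie_zero, map_zero] at h
  exact sub_eq_zero.1 h.symm

/-- The restricted enveloping algebra of an abelian restricted Lie algebra is commutative. -/
abbrev uEnvCommRing [IsLieAbelian H] : CommRing (uEnv p F H) :=
  { (inferInstance : Ring (uEnv p F H)) with mul_comm := uEnv_mul_comm p F H }

variable [Fact p.Prime]

lemma uEnv_nontrivial : Nontrivial (uEnv p F H) :=
  (aug p F H).toRingHom.domain_nontrivial

variable [CharP F p]

lemma uemb_injective_of_abelian [IsLieAbelian H] : Function.Injective (uemb p F H) :=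
  uemb_injective p fun x y w => by rw [trivial_lie_zero]

lemma pmap_add [IsLieAbelian H] (x y : H) :
    pmap p F H (x + y) = pmap p F H x + pmap p F H y := by
  have := uEnv_nontrivial p F H
  have : CharP (uEnv p F H) p :=
    charP_of_injective_algebraMap (algebraMap F (uEnv p F H)).injective p
  apply uemb_injective_of_abelian p F H
  rw [← uemb_pow, map_add, map_add, ← uemb_pow, ← uemb_pow]
  exact add_pow_char_of_commute _ (uEnv_mul_comm p F H _ _)

/-- The `p`-map of an abelian restricted Lie algebra, as a Frobenius-semilinear map. -/
def pmapSemilinear [IsLieAbelian H] : H →ₛₗ[frobenius F p] H where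
  toFun := pmap p F H
  map_add' := pmap_add p F H
  map_smul' := RestrictedLieAlgebra.pOp_smul

attribute [local instance] uEnvCommRing in
lemma isPowerEnvelope_uemb [IsLieAbelian H] :
    IsPowerEnvelope (pmapSemilinear p F H) (uemb p F H) where
  pow_eq := uemb_pow p
  adjoin_eq_top := adjoin_range_uemb p
  mem_relIdeal {κ} _ b P hP := by
    let ρ : H →ₗ⁅F⁆ PowerQuotient (pmapSemilinear p F H) b :=
      { toPowerQuotient (pmapSemilinear p F H) b with
        map_lie' := fun {x y} => by
          rw [LieRing.of_associative_ring_bracket, mul_comm, sub_self, trivial_lie_zero]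
          exact map_zero (toPowerQuotient (pmapSemilinear p F H) b) }
    exact mem_relIdeal_of_toPowerQuotient b
      (uLift p ρ fun x => toPowerQuotient_pow (pmapSemilinear p F H) b x) (uLift_uemb p ρ _) P hP

attribute [local instance] uEnvCommRing in
lemma uEnv_finite [IsLieAbelian H] [FiniteDimensional F H] : Module.Finite F (uEnv p F H) :=
  (isPowerEnvelope_uemb p F H).finite

attribute [local instance] uEnvCommRing in
lemma finrank_adjoin_uEnv_pow [IsLieAbelian H] [FiniteDimensional F H] (n : ℕ) :
    finrank F (Algebra.adjoin F (Set.range fun a : uEnv p F H => a ^ p ^ n)) =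
      p ^ finrank F (Submodule.span F (Set.range (pmapSemilinear p F H)^[n])) := by
  have := uEnv_nontrivial p F H
  exact (isPowerEnvelope_uemb p F H).finrank_adjoin_pow n

end RestrictedLieAlgebra

open RestrictedLieAlgebra in
/-- If `L` is a finite-dimensional abelian restricted Lie algebra over an algebraically
closed field `F` of characteristic `p > 0` and `H` is a restricted Lie algebra with
`u(L) ≅ u(H)` as `F`-algebras, then `L ≅ H` as restricted Lie algebras. -/
theorem abelian_algclosed_determined
    (p : ℕ) (F L H : Type*) [Field F] [Fact p.Prime] [CharP F p] [IsAlgClosed F]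
    [LieRing L] [LieAlgebra F L] [RestrictedLieAlgebra p F L]
    [LieRing H] [LieAlgebra F H] [RestrictedLieAlgebra p F H]
    [FiniteDimensional F L] [IsLieAbelian L]
    (hiso : Nonempty (uEnv p F L ≃ₐ[F] uEnv p F H)) :
    ∃ e : L ≃ₗ[F] H,
      (∀ x y : L, e ⁅x, y⁆ = ⁅e x, e y⁆) ∧
      (∀ x : L, e (pmap p F L x) = pmap p F H (e x)) := by
  obtain ⟨g⟩ := hiso
  have hH : IsLieAbelian H := isLieAbelian_of_uEnv_comm p (F := F) fun a b => g.symm.injective (by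
    rw [map_mul, map_mul, uEnv_mul_comm])
  have hL := uEnv_finite p F L
  have hu : Module.Finite F (uEnv p F H) := Module.Finite.equiv g.toLinearEquiv
  have hfin : FiniteDimensional F H :=
    Module.Finite.of_injective (uemb p F H) (uemb_injective_of_abelian p F H)
  have hperfect : PerfectRing F p := PerfectField.toPerfectRing p
  have hrank : ∀ n, Module.finrank F
        (Submodule.span F (Set.range (pmapSemilinear p F L)^[n])) =
      Module.finrank F (Submodule.span F (Set.range (pmapSemilinear p F H)^[n])) := by
    intro n
    apply Nat.pow_right_injective (Fact.out : p.Prime).two_le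
    have hmap : (Algebra.adjoin F (Set.range fun a : uEnv p F L => a ^ p ^ n)).map g.toAlgHom =
        Algebra.adjoin F (Set.range fun a : uEnv p F H => a ^ p ^ n) := by
      rw [AlgHom.map_adjoin, ← Set.range_comp]
      congr 1
      rw [← g.surjective.range_comp]
      congr 1
      ext a
      exact map_pow g a _
    change p ^ _ = p ^ _
    rw [← finrank_adjoin_uEnv_pow, ← finrank_adjoin_uEnv_pow, ← hmap]
    exact (Submodule.equivMapOfInjective g.toLinearMap g.injective (Subalgebra.toSubmodule
      (Algebra.adjoin F (Set.range fun a : uEnv p F L => a ^ p ^ n)))).finrank_eq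
  obtain ⟨e, he⟩ := TruncatedPolynomial.exists_equivariant_equiv _ _ hrank
  exact ⟨e, fun x y => by rw [trivial_lie_zero, trivial_lie_zero, map_zero], he⟩
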